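/- Let d be a prime, k ≥ 1, and let ζ ≠ 1 be a d-th root of unity. Suppose c_0 ∈ ℂ is a root of the Misiurewicz polynomial G_{d,m,n}^ζ for some m ≥ 2, n ≥ 1, and set K = ℚ(c_0). Then there exist a polynomial F(x) ∈ O_K[x] and a unit u ∈ O_K^× such that f_{d,c_0}^k(x) = x^{d^k} + d·x^d·F(x) + u·a_i(c_0), where i = gcd(k,n). -/

import Mathlib

open Polynomial IntermediateField

noncomputable section

/-- The value sequence `a_i(c)`: `a_0 = 0`, `a_{i+1} = a_i ^ d + c`. -/
def aSeq (d : ℕ) {F : Type*} [CommRing F] (c : F) : ℕ → F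
  | 0 => 0
  | i + 1 => aSeq d c i ^ d + c

/-- The polynomials `a_i ∈ ℤ[c]`: `a_0 = 0`, `a_{i+1} = a_i ^ d + c`. -/
def aPoly (d : ℕ) : ℕ → Polynomial ℤ
  | 0 => 0
  | i + 1 => aPoly d i ^ d + X

/-- Iterates of `f_{d,c} = x^d + c`: `f^0 = x`, `f^{k+1} = f ∘ f^k`. -/
def fIter (d : ℕ) {F : Type*} [CommRing F] (c : F) : ℕ → Polynomial F
  | 0 => X
  | k + 1 => fIter d c k ^ d + C c

/-- `c₀` is a root of the Gleason polynomial `G_{d,n} = ∏_{k ∣ n} a_k^{μ(n/k)}`. -/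
def isGleasonRoot (d n : ℕ) (c₀ : ℂ) : Prop :=
  ∃ g : Polynomial ℤ,
    g * ∏ k ∈ n.divisors, aPoly d k ^ ((-(ArithmeticFunction.moebius (n / k))).toNat)
        = ∏ k ∈ n.divisors, aPoly d k ^ ((ArithmeticFunction.moebius (n / k)).toNat)
    ∧ Polynomial.aeval c₀ g = 0

/-- `c₀` is a root of the Misiurewicz polynomial `G_{d,m,n}^ζ`. -/
def isMisiurewiczRoot (d m n : ℕ) (ζ c₀ : ℂ) : Prop :=
  ∃ g : Polynomial ℂ,
    g * ((∏ k ∈ n.divisors,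
            ((aPoly d (m + k - 1)).map (Int.castRingHom ℂ) -
              C ζ * (aPoly d (m - 1)).map (Int.castRingHom ℂ))
                ^ ((-(ArithmeticFunction.moebius (n / k))).toNat)) *
          (if n ∣ (m - 1) then
            ∏ k ∈ n.divisors, ((aPoly d k).map (Int.castRingHom ℂ))
                ^ ((ArithmeticFunction.moebius (n / k)).toNat)
          else 1))
        = (∏ k ∈ n.divisors,
            ((aPoly d (m + k - 1)).map (Int.castRingHom ℂ) -
              C ζ * (aPoly d (m - 1)).map (Int.castRingHom ℂ))
                ^ ((ArithmeticFunction.moebius (n / k)).toNat)) *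
          (if n ∣ (m - 1) then
            ∏ k ∈ n.divisors, ((aPoly d k).map (Int.castRingHom ℂ))
                ^ ((-(ArithmeticFunction.moebius (n / k))).toNat)
          else 1)
    ∧ g.eval c₀ = 0

/-- The polynomial `F_{k,i}^{(d,c₀)} = ∏_{j=1}^{d-1} (f_{d,c₀}^k - ζ^j a_i(c₀))` over `ℂ`. -/
def FPoly (d : ℕ) (c₀ ζ : ℂ) (k i : ℕ) : Polynomial ℂ :=
  ∏ j ∈ Finset.Icc 1 (d - 1), (fIter d c₀ k - C (ζ ^ j * aSeq d c₀ i))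


theorem map_aSeq (d : ℕ) {R S : Type*} [CommRing R] [CommRing S] (φ : R →+* S) (c : R) (j : ℕ) :
    φ (aSeq d c j) = aSeq d (φ c) j := by
  induction j with
  | zero => simp [aSeq]
  | succ j ih => simp [aSeq, ih]

theorem aPoly_eq_aSeq (d j : ℕ) : aPoly d j = aSeq d (X : ℤ[X]) j := by
  induction j with
  | zero => rfl
  | succ j ih => simp [aSeq, aPoly, ih]

theorem aeval_aPoly (d : ℕ) {R : Type*} [CommRing R] [Algebra ℤ R] (c : R) (j : ℕ) :
    aeval c (aPoly d j) = aSeq d c j := by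
  rw [aPoly_eq_aSeq]
  simpa using map_aSeq d (aeval c : ℤ[X] →ₐ[ℤ] R).toRingHom X j

theorem eval_map_aPoly (d : ℕ) (c : ℂ) (j : ℕ) :
    ((aPoly d j).map (Int.castRingHom ℂ)).eval c = aSeq d c j := by
  rw [← aeval_aPoly, aeval_def, eval_map]
  rfl

theorem map_fIter (d : ℕ) {R S : Type*} [CommRing R] [CommRing S] (φ : R →+* S) (c : R) (k : ℕ) :
    (fIter d c k).map φ = fIter d (φ c) k := by
  induction k with
  | zero => simp [fIter]
  | succ k ih => simp [fIter, ih]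

/-- `x ↦ x ^ d + c` preserves congruences, so `a_k ≡ 0` forces `k` to be a period. -/
theorem aSeq_dvd_add_sub (d : ℕ) {R : Type*} [CommRing R] (c : R) (j k : ℕ) :
    aSeq d c k ∣ aSeq d c (j + k) - aSeq d c j := by
  induction j with
  | zero => simp [aSeq]
  | succ j ih =>
    rw [Nat.add_right_comm]
    simpa [aSeq] using ih.trans (sub_dvd_pow_sub_pow _ _ d)

theorem aSeq_dvd_add_mul_sub (d : ℕ) {R : Type*} [CommRing R] (c : R) (j k l : ℕ) :
    aSeq d c k ∣ aSeq d c (j + l * k) - aSeq d c j := by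
  induction l with
  | zero => simp
  | succ l ih =>
    have h := dvd_add (aSeq_dvd_add_sub d c (j + l * k) k) ih
    rwa [sub_add_sub_cancel, Nat.add_assoc, ← Nat.succ_mul] at h

theorem aSeq_dvd_of_dvd (d : ℕ) {R : Type*} [CommRing R] (c : R) {i k : ℕ} (h : i ∣ k) :
    aSeq d c i ∣ aSeq d c k := by
  obtain ⟨l, rfl⟩ := h
  simpa [aSeq, Nat.mul_comm] using aSeq_dvd_add_mul_sub d c 0 i l

theorem dvd_aSeq_gcd (d : ℕ) {R : Type*} [CommRing R] (c x : R) (k n : ℕ) :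
    x ∣ aSeq d c k → x ∣ aSeq d c n → x ∣ aSeq d c (Nat.gcd k n) := by
  induction k, n using Nat.gcd.induction with
  | H0 n => intro _ h; simpa using h
  | H1 k n _ ih =>
    intro hk hn
    rw [Nat.gcd_rec]
    refine ih ?_ hk
    have h := hk.trans (aSeq_dvd_add_mul_sub d c (n % k) k (n / k))
    rw [Nat.mod_add_div'] at h
    exact (dvd_sub_right hn).1 h

theorem aSeq_add_period (d : ℕ) {R : Type*} [CommRing R] {c : R} {m k : ℕ}
    (h : aSeq d c (m + k) = aSeq d c m) (j : ℕ) :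
    aSeq d c (m + j + k) = aSeq d c (m + j) := by
  induction j with
  | zero => simpa using h
  | succ j ih =>
    rw [← Nat.add_assoc, Nat.add_right_comm]
    simp [aSeq, ih]

theorem aSeq_add_mul_period (d : ℕ) {R : Type*} [CommRing R] {c : R} {m k : ℕ}
    (h : aSeq d c (m + k) = aSeq d c m) (l : ℕ) :
    aSeq d c (m + l * k) = aSeq d c m := by
  induction l with
  | zero => simp
  | succ l ih => rw [Nat.succ_mul, ← Nat.add_assoc, aSeq_add_period d h, ih]

theorem aSeq_add_period_of_dvd (d : ℕ) {R : Type*} [CommRing R] {c : R} {m k n : ℕ}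
    (h : aSeq d c (m + k) = aSeq d c m) (hkn : k ∣ n) :
    aSeq d c (m + n) = aSeq d c m := by
  obtain ⟨l, rfl⟩ := hkn
  rw [Nat.mul_comm]
  exact aSeq_add_mul_period d h l

theorem aSeq_dvd_aSeq_period (d : ℕ) {R : Type*} [CommRing R] {c : R} {m n k : ℕ}
    (h : aSeq d c (m + n) = aSeq d c m) (hk : 1 ≤ k) :
    aSeq d c k ∣ aSeq d c n := by
  have h1 : aSeq d c (n + m * k) = aSeq d c (m * k) := by
    obtain ⟨t, ht⟩ := Nat.exists_eq_add_of_le (Nat.le_mul_of_pos_right m hk)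
    rw [Nat.add_comm, ht]
    exact aSeq_add_period d h t
  have h2 := aSeq_dvd_add_mul_sub d c n k m
  rw [h1] at h2
  exact (dvd_sub_right (aSeq_dvd_of_dvd d c (Dvd.intro_left m rfl))).1 h2

theorem aSeq_gcd_associated (d : ℕ) {R : Type*} [CommRing R] [IsDomain R] {c : R} {m n k : ℕ}
    (h : aSeq d c (m + n) = aSeq d c m) (hk : 1 ≤ k) :
    Associated (aSeq d c (Nat.gcd k n)) (aSeq d c k) :=
  associated_of_dvd_dvd (aSeq_dvd_of_dvd d c (Nat.gcd_dvd_left k n))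
    (dvd_aSeq_gcd d c _ k n dvd_rfl (aSeq_dvd_aSeq_period d h hk))

theorem fIter_eq (d : ℕ) (hd : d.Prime) {R : Type*} [CommRing R] (c : R) (k : ℕ) :
    ∃ F : R[X], fIter d c (k + 1) =
      X ^ d ^ (k + 1) + C (d : R) * X ^ d * F + C (aSeq d c (k + 1)) := by
  induction k with
  | zero => exact ⟨0, by simp [fIter, aSeq, hd.ne_zero]⟩
  | succ k ih =>
    obtain ⟨F, hF⟩ := ih
    obtain ⟨A, hA⟩ : (X ^ d : R[X]) ∣ X ^ d ^ (k + 1) :=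
      pow_dvd_pow _ (Nat.le_self_pow k.succ_ne_zero d)
    obtain ⟨S, hS⟩ : ∃ S : R[X], ∀ x y : R[X], x = X ^ d ^ (k + 1) →
        y = C (d : R) * X ^ d * F + C (aSeq d c (k + 1)) →
        (x + y) ^ d = x ^ d + y ^ d + d * x * y * S :=
      ⟨_, by rintro _ _ rfl rfl; exact add_pow_prime_eq hd _ _⟩
    obtain ⟨T, hT⟩ := sub_dvd_pow_sub_pow
      (C (d : R) * X ^ d * F + C (aSeq d c (k + 1))) (C (aSeq d c (k + 1))) d
    rw [add_sub_cancel_right, sub_eq_iff_eq_add] at hT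
    refine ⟨A * (C (d : R) * X ^ d * F + C (aSeq d c (k + 1))) * S + F * T, ?_⟩
    rw [fIter, hF, add_assoc, hS _ _ rfl rfl, hT, ← pow_mul, ← pow_succ, hA,
      show aSeq d c (k + 1 + 1) = aSeq d c (k + 1) ^ d + c from rfl, C_add, C_pow, map_natCast]
    ring

theorem aPoly_succ_monic_natDegree (d : ℕ) (hd : d.Prime) (j : ℕ) :
    (aPoly d (j + 1)).Monic ∧ (aPoly d (j + 1)).natDegree = d ^ j := by
  induction j with
  | zero => simp [aPoly, hd.ne_zero, monic_X]
  | succ j ih =>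
    obtain ⟨hm, hdeg⟩ := ih
    have hlt : (X : ℤ[X]).degree < (aPoly d (j + 1) ^ d).degree := by
      rw [degree_X, degree_eq_natDegree (hm.pow d).ne_zero, hm.natDegree_pow, hdeg]
      exact_mod_cast hd.one_lt.trans_le (Nat.le_mul_of_pos_right d (pow_pos hd.pos j))
    rw [aPoly]
    refine ⟨(hm.pow d).add_of_left hlt, ?_⟩
    rw [natDegree_add_eq_left_of_degree_lt hlt, hm.natDegree_pow, hdeg, pow_succ']

theorem isIntegral_of_aSeq_period (d : ℕ) (hd : d.Prime) {R : Type*} [CommRing R] [Algebra ℤ R]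
    {c : R} {m n : ℕ} (hn : 1 ≤ n) (h : aSeq d c (m + n) = aSeq d c m) : IsIntegral ℤ c := by
  obtain ⟨hM, hD⟩ := aPoly_succ_monic_natDegree d hd (m + n)
  obtain ⟨hM', hD'⟩ := aPoly_succ_monic_natDegree d hd m
  refine ⟨aPoly d (m + n + 1) - aPoly d (m + 1), hM.sub_of_left ?_, ?_⟩
  · rw [degree_eq_natDegree hM.ne_zero, degree_eq_natDegree hM'.ne_zero, hD, hD']
    exact_mod_cast Nat.pow_lt_pow_right hd.one_lt (by omega)
  · rw [← aeval_def, map_sub, aeval_aPoly, aeval_aPoly, aSeq, aSeq, h, sub_self]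

/-- The critical orbit of a Misiurewicz parameter is eventually periodic with period `n`. -/
theorem isMisiurewiczRoot.exists_aSeq_period {d m n : ℕ} {ζ c₀ : ℂ}
    (hc₀ : isMisiurewiczRoot d m n ζ c₀) (hζd : ζ ^ d = 1) (hm : 2 ≤ m) :
    ∃ M, aSeq d c₀ (M + n) = aSeq d c₀ M := by
  obtain ⟨g, hg, hg0⟩ := hc₀
  have h := congrArg (eval c₀) hg
  rw [eval_mul, hg0, zero_mul, eval_mul, eq_comm, mul_eq_zero] at h
  rcases h with h | h
  · rw [eval_prod, Finset.prod_eq_zero_iff] at h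
    obtain ⟨k, hk, h⟩ := h
    rw [eval_pow] at h
    have h := eq_zero_of_pow_eq_zero h
    rw [eval_sub, eval_mul, eval_C, eval_map_aPoly, eval_map_aPoly, sub_eq_zero] at h
    refine ⟨m, aSeq_add_period_of_dvd d ?_ (Nat.dvd_of_mem_divisors hk)⟩
    obtain ⟨m, rfl⟩ := Nat.exists_eq_add_of_le' hm
    have e : m + 2 + k - 1 = m + 1 + k := by omega
    rw [e] at h
    rw [show m + 2 + k = m + 1 + k + 1 by omega, aSeq, h, mul_pow, hζd, one_mul]
    rfl
  · split_ifs at h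
    · rw [eval_prod, Finset.prod_eq_zero_iff] at h
      obtain ⟨k, hk, h⟩ := h
      rw [eval_pow] at h
      have h := eq_zero_of_pow_eq_zero h
      rw [eval_map_aPoly] at h
      exact ⟨0, aSeq_add_period_of_dvd d (by simpa [aSeq] using h) (Nat.dvd_of_mem_divisors hk)⟩
    · simp at h

theorem exists_fIter_eq_of_aSeq_period (d : ℕ) (hd : d.Prime) {K : Type*} [Field K] [Algebra ℤ K]
    {α : K} {M n k : ℕ} (hk : 1 ≤ k) (hn : 1 ≤ n) (hα : aSeq d α (M + n) = aSeq d α M) :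
    ∃ (F : Polynomial (integralClosure ℤ K)) (u : (integralClosure ℤ K)ˣ),
      fIter d α k =
        X ^ d ^ k + C ((d : ℕ) : K) * X ^ d * F.map (algebraMap (integralClosure ℤ K) K)
          + C (((u : integralClosure ℤ K) : K) * aSeq d α (Nat.gcd k n)) := by
  have hint : IsIntegral ℤ α := isIntegral_of_aSeq_period d hd hn hα
  obtain ⟨x, rfl⟩ : ∃ x : integralClosure ℤ K, algebraMap _ K x = α := ⟨⟨α, hint⟩, rfl⟩
  have hx : aSeq d x (M + n) = aSeq d x M := by
    apply FaithfulSMul.algebraMap_injective (integralClosure ℤ K) K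
    rw [map_aSeq, map_aSeq, hα]
  obtain ⟨u, hu⟩ := aSeq_gcd_associated d hx hk
  obtain ⟨k, rfl⟩ := Nat.exists_eq_add_of_le' hk
  obtain ⟨F, hF⟩ := fIter_eq d hd x k
  refine ⟨F, u, ?_⟩
  rw [← map_fIter, hF, ← hu, ← map_aSeq, mul_comm (aSeq d x _)]
  simp only [Polynomial.map_add, Polynomial.map_mul, Polynomial.map_pow, map_X, map_C, map_mul,
    map_natCast, Polynomial.map_natCast, Subalgebra.algebraMap_def,
    Algebra.algebraMap_self, RingHom.id_apply]

set_option maxHeartbeats 1000000 in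
set_option synthInstance.maxHeartbeats 400000 in
/-- If `c₀` is a Misiurewicz parameter (root of `G_{d,m,n}^ζ`) and
`K = ℚ(c₀)` with ring of integers `O_K`, then for every `k ≥ 1` there are `F ∈ O_K[x]` and a
unit `u ∈ O_K^×` with `f_{d,c₀}^k(x) = x^{d^k} + d x^d F(x) + u a_i(c₀)`, `i = gcd(k,n)`. -/
theorem stmt11 (d : ℕ) (hd : Nat.Prime d) (k : ℕ) (hk : 1 ≤ k)
    (ζ : ℂ) (hζ1 : ζ ≠ 1) (hζd : ζ ^ d = 1)
    (m n : ℕ) (hm : 2 ≤ m) (hn : 1 ≤ n)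
    (c₀ : ℂ) (hc₀ : isMisiurewiczRoot d m n ζ c₀) :
    ∃ (F : Polynomial (integralClosure ℤ ℚ⟮c₀⟯)) (u : (integralClosure ℤ ℚ⟮c₀⟯)ˣ),
      fIter d (IntermediateField.AdjoinSimple.gen ℚ c₀) k =
        X ^ d ^ k
          + C ((d : ℕ) : ℚ⟮c₀⟯) * X ^ d
              * F.map (algebraMap (integralClosure ℤ ℚ⟮c₀⟯) ℚ⟮c₀⟯)
          + C (((u : integralClosure ℤ ℚ⟮c₀⟯) : ℚ⟮c₀⟯)
              * aSeq d (IntermediateField.AdjoinSimple.gen ℚ c₀) (Nat.gcd k n)) := by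
  obtain ⟨M, hM⟩ := hc₀.exists_aSeq_period hζd hm
  have hα : aSeq d (AdjoinSimple.gen ℚ c₀) (M + n) = aSeq d (AdjoinSimple.gen ℚ c₀) M := by
    apply (algebraMap ℚ⟮c₀⟯ ℂ).injective
    rw [map_aSeq, map_aSeq, AdjoinSimple.algebraMap_gen, hM]
  exact exists_fIter_eq_of_aSeq_period d hd hk hn hα
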